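/- For all positive integers k and p, the number of domino tilings of the region T(k,2k,p) is odd. -/

import Mathlib

/-- Two cells of `ℤ × ℤ` are adjacent if they differ by `(1,0)` or `(0,1)`. -/
def Adjacent (a b : ℤ × ℤ) : Prop :=
  (a.1 = b.1 ∧ (a.2 = b.2 + 1 ∨ b.2 = a.2 + 1)) ∨
  (a.2 = b.2 ∧ (a.1 = b.1 + 1 ∨ b.1 = a.1 + 1))

/-- `T` is a domino tiling of `R`: a partition of `R` into two-element sets of adjacent cells. -/
def IsDominoTiling (R : Set (ℤ × ℤ)) (T : Set (Set (ℤ × ℤ))) : Prop :=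
  (∀ d ∈ T, ∃ a b, Adjacent a b ∧ d = {a, b}) ∧
  T.PairwiseDisjoint id ∧
  ⋃₀ T = R

/-- The number of domino tilings of `R`. -/
noncomputable def numTilings (R : Set (ℤ × ℤ)) : ℕ :=
  Nat.card {T : Set (Set (ℤ × ℤ)) // IsDominoTiling R T}

/-- The region `T(i,j,p)`: rows `r = 0, …, i+p-2` from top to bottom of lengths
`j, j+2, …, j+2(p-2)` followed by `i` rows of length `j+2(p-1)`, centers aligned. -/
def Treg (i j p : ℕ) : Set (ℤ × ℤ) :=
  {q | 0 ≤ q.2 ∧ q.2 ≤ (i : ℤ) + p - 2 ∧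
    (p : ℤ) - 1 - min q.2 ((p : ℤ) - 1) ≤ q.1 ∧
    q.1 ≤ (p : ℤ) - 2 + j + min q.2 ((p : ℤ) - 1)}

open Classical in
lemma det_eq_count {V : Type*} [Fintype V] (adj : V → V → Prop)
    (hs : ∀ a b, adj a b → adj b a)
    (hker : ∀ v : V → ZMod 2, (∀ u, ∑ x, (if adj u x then v x else 0) = 0) → v = 0) :
    Odd (Fintype.card {σ : Equiv.Perm V // (∀ v, adj (σ v) v) ∧ ∀ v, σ (σ v) = v}) := by
  have hdet : (Matrix.of (fun u v : V => if adj u v then (1 : ZMod 2) else 0)).det ≠ 0 := by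
    intro hdet
    obtain ⟨v, hv0, hv⟩ := Matrix.exists_mulVec_eq_zero_iff.mpr hdet
    apply hv0
    apply hker
    intro u
    have e := congrFun hv u
    simpa only [Matrix.mulVec, dotProduct, Matrix.of_apply, Pi.zero_apply, ite_mul, one_mul,
      zero_mul] using e
  set S := {σ : Equiv.Perm V // ∀ v, adj (σ v) v} with hS
  have h1 : (Matrix.of (fun u v : V => if adj u v then (1 : ZMod 2) else 0)).det
      = (Fintype.card S : ZMod 2) := by
    rw [Matrix.det_apply, Fintype.card_subtype, Finset.card_filter]
    push_cast
    refine Finset.sum_congr rfl fun σ _ => ?_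
    have : ∀ (u : ℤˣ) (x : ZMod 2), u • x = x := by
      intro u x
      rcases Int.units_eq_one_or u with rfl | rfl
      · simp
      · rw [Units.neg_smul, one_smul]; exact ZMod.neg_eq_self_mod_two x
    rw [this]
    simp only [Matrix.of_apply]
    rw [Finset.prod_ite_zero]
    simp
  let I : Equiv.Perm S := Function.Involutive.toPerm
    (fun σ => ⟨σ.1⁻¹, fun v => by
      have := hs _ _ (σ.2 (σ.1⁻¹ v))
      simpa using this⟩) (fun σ => by simp)
  have hI : I ^ 2 ^ 1 = 1 := by
    rw [pow_one, pow_two]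
    exact Equiv.ext (fun σ => Subtype.ext (inv_inv σ.1))
  have h2 : Fintype.card S ≡ Fintype.card (Function.fixedPoints I) [MOD 2] := by
    refine Equiv.Perm.card_fixedPoints_modEq (p := 2) (n := 1) (f := (I : S → S)) ?_
    exact congrArg (fun g : Equiv.Perm S => (g : S → S)) hI
  have h3 : Fintype.card (Function.fixedPoints I)
      = Fintype.card {σ : Equiv.Perm V // (∀ v, adj (σ v) v) ∧ ∀ v, σ (σ v) = v} := by
    refine Fintype.card_congr ⟨fun s => ⟨s.1.1, s.1.2, fun v => ?_⟩,
      fun s => ⟨⟨s.1, s.2.1⟩, ?_⟩, fun _ => rfl, fun _ => rfl⟩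
    · have h := s.2
      have h : s.1.1⁻¹ = s.1.1 := congrArg Subtype.val h
      conv_lhs => enter [2]; rw [← h]
      simp
    · apply Subtype.ext
      change s.1⁻¹ = s.1
      rw [inv_eq_iff_mul_eq_one]
      ext v
      simpa using s.2.2 v
  rw [← h3]
  rw [h1] at hdet
  have h4 : ¬ Even (Fintype.card S) := by
    rwa [← ZMod.natCast_eq_zero_iff_even]
  rw [Nat.not_even_iff_odd, Nat.odd_iff] at h4
  rw [Nat.odd_iff, ← h4]
  exact h2.symm

lemma adj_symm (a b : ℤ × ℤ) (h : Adjacent a b) : Adjacent b a := by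
  unfold Adjacent at *; omega

lemma adj_ne (a b : ℤ × ℤ) (h : Adjacent a b) : a ≠ b := by
  rintro rfl
  unfold Adjacent at *; omega

lemma count_tilings (R : Set (ℤ × ℤ)) :
    Nat.card {σ : Equiv.Perm R // (∀ v, Adjacent (σ v).1 v.1) ∧ ∀ v, σ (σ v) = v}
      = numTilings R := by
  unfold numTilings
  refine Nat.card_congr (Equiv.ofBijective (fun σ => ⟨{d | ∃ v : R, d = {v.1, (σ.1 v).1}}, ?_, ?_, ?_⟩) ⟨?_, ?_⟩)
  · rintro d ⟨v, rfl⟩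
    exact ⟨_, _, adj_symm _ _ (σ.2.1 v), rfl⟩
  · rintro d ⟨v, rfl⟩ e ⟨w, rfl⟩ hne
    simp only [Function.onFun, id]
    rw [Set.disjoint_left]
    rintro z hz1 hz2
    apply hne
    have hvv := σ.2.2 v
    have hww := σ.2.2 w
    rcases hz1 with h | h <;> rcases hz2 with h' | h'
    · have : v = w := Subtype.ext (h.symm.trans h')
      rw [this]
    · have : v = σ.1 w := Subtype.ext (h.symm.trans h')
      rw [this, hww, Set.pair_comm]
    · have : σ.1 v = w := Subtype.ext (h.symm.trans h')
      rw [← this, hvv, Set.pair_comm]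
    · have : σ.1 v = σ.1 w := Subtype.ext (h.symm.trans h')
      rw [σ.1.injective this]
  · ext z
    constructor
    · rintro ⟨d, ⟨v, rfl⟩, h | h⟩
      · rw [h]; exact v.2
      · rw [h]; exact (σ.1 v).2
    · intro hz
      exact ⟨_, ⟨⟨z, hz⟩, rfl⟩, Or.inl rfl⟩
  · intro σ τ h
    have h : {d : Set (ℤ × ℤ) | ∃ v : R, d = {v.1, (σ.1 v).1}} = {d | ∃ v : R, d = {v.1, (τ.1 v).1}} :=
      congrArg Subtype.val h
    apply Subtype.ext
    ext1 v
    have hm : ({v.1, (σ.1 v).1} : Set (ℤ × ℤ)) ∈ {d : Set (ℤ × ℤ) | ∃ v : R, d = {v.1, (τ.1 v).1}} := by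
      rw [← h]; exact ⟨v, rfl⟩
    obtain ⟨w, hw⟩ := hm
    have hne := adj_ne _ _ (σ.2.1 v)
    have hv : v.1 ∈ ({w.1, (τ.1 w).1} : Set (ℤ × ℤ)) := by rw [← hw]; exact Or.inl rfl
    have hv2 : (σ.1 v).1 ∈ ({w.1, (τ.1 w).1} : Set (ℤ × ℤ)) := by rw [← hw]; exact Or.inr rfl
    have hww := τ.2.2 w
    rcases hv with h1 | h1 <;> rcases hv2 with h2 | h2
    · exact absurd (h2.trans h1.symm) hne
    · have e1 : v = w := Subtype.ext h1
      rw [Subtype.ext_iff, h2, e1]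
    · have e1 : v = τ.1 w := Subtype.ext h1
      have e2 : σ.1 v = w := Subtype.ext h2
      rw [e2, e1, hww]
    · exact absurd (h2.trans h1.symm) hne
  · rintro ⟨T, h1, h2, h3⟩
    have key : ∀ v : R, ∃ w : R, Adjacent w.1 v.1 ∧ ({v.1, w.1} : Set (ℤ × ℤ)) ∈ T := by
      intro v
      have hv : v.1 ∈ ⋃₀ T := by rw [h3]; exact v.2
      obtain ⟨d, hd, hvd⟩ := hv
      obtain ⟨a, b, hab, rfl⟩ := h1 d hd
      have ha : a ∈ R := by rw [← h3]; exact ⟨_, hd, Or.inl rfl⟩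
      have hb : b ∈ R := by rw [← h3]; exact ⟨_, hd, Or.inr rfl⟩
      rcases hvd with h | h
      · exact ⟨⟨b, hb⟩, by rw [h]; exact adj_symm _ _ hab, by rw [h]; exact hd⟩
      · have h : v.1 = b := h
        exact ⟨⟨a, ha⟩, by rw [h]; exact hab, by rw [h, Set.pair_comm]; exact hd⟩
    choose s hs1 hs2 using key
    have uniq : ∀ d ∈ T, ∀ v : R, v.1 ∈ d → d = {v.1, (s v).1} := by
      intro d hd v hv
      by_contra hne
      have := h2 hd (hs2 v) hne
      simp only [Function.onFun, id] at this
      rw [Set.disjoint_left] at this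
      exact this hv (Or.inl rfl)
    have hinv : ∀ v, s (s v) = v := by
      intro v
      have h := uniq _ (hs2 v) (s v) (Or.inr rfl)
      have h' : v.1 ∈ ({(s v).1, (s (s v)).1} : Set (ℤ × ℤ)) := by rw [← h]; exact Or.inl rfl
      rcases h' with h' | h'
      · exact absurd h'.symm (adj_ne _ _ (hs1 v))
      · exact Subtype.ext h'.symm
    refine ⟨⟨Function.Involutive.toPerm s hinv, hs1, hinv⟩, ?_⟩
    apply Subtype.ext
    ext d
    constructor
    · rintro ⟨v, rfl⟩
      exact hs2 v
    · intro hd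
      obtain ⟨a, b, hab, hdd⟩ := h1 d hd
      have had : a ∈ d := by rw [hdd]; exact Or.inl rfl
      have ha : a ∈ R := by rw [← h3]; exact ⟨_, hd, had⟩
      exact ⟨⟨a, ha⟩, uniq d hd ⟨a, ha⟩ had⟩

/-- discrete antiderivative with step two -/
def hseq (a : ℤ → ZMod 2) : ℕ → ZMod 2
  | 0 => 0
  | 1 => 0
  | n + 2 => hseq a n + a ((n : ℤ) + 1)

lemma z2 (a b : ZMod 2) : a + b = 0 ↔ a = b := by
  revert a b; decide

lemma kernel_trivial (k N : ℤ) (hk : 1 ≤ k) (hN : k ≤ N) (F : ℤ → ℤ → ZMod 2)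
    (h0 : ∀ x y, ¬ (1 ≤ y ∧ y ≤ N ∧ 1 ≤ x ∧ y - k + 1 ≤ x ∧ x ≤ 2 * N ∧ x ≤ 2 * N - (y - k)) →
      F x y = 0)
    (h1 : ∀ x y, (1 ≤ y ∧ y ≤ N ∧ 1 ≤ x ∧ y - k + 1 ≤ x ∧ x ≤ 2 * N ∧ x ≤ 2 * N - (y - k)) →
      F x (y + 1) + F x (y - 1) + F (x + 1) y + F (x - 1) y = 0) :
    ∀ x y, F x y = 0 := by
  obtain ⟨H, hH1, hH2, hH3⟩ : ∃ H : ℤ → ZMod 2, (∀ x, 1 ≤ x → x ≤ 2 * N → F x 1 = H (x + 1) + H (x - 1)) ∧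
      (∀ n, 0 ≤ n → n ≤ 2 * N + 1 → H (-n) = H n) ∧
      (∀ n, H (2 * N + 1 + n) = H (2 * N + 1 - n)) := by
    refine ⟨fun n => hseq (fun x => F x 1) (if n ≤ 2 * N + 1 then n else 2 * (2 * N + 1) - n).natAbs,
      ?_, ?_, ?_⟩
    · intro x hx hx2
      obtain ⟨n, rfl⟩ : ∃ n : ℕ, x = n + 1 := ⟨(x - 1).toNat, by omega⟩
      simp only
      rw [if_pos (by omega), if_pos (by omega)]
      have e1 : ((n : ℤ) + 1 + 1).natAbs = n + 2 := by omega
      have e2 : ((n : ℤ) + 1 - 1).natAbs = n := by omega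
      rw [e1, e2, hseq]
      generalize hseq _ n = u
      generalize F _ _ = v
      revert u v; decide
    · intro n hn hn2
      simp only
      rw [if_pos (by omega), if_pos (by omega), Int.natAbs_neg]
    · intro n
      simp only
      congr 2
      split_ifs <;> omega
  have claim : ∀ n : ℕ, ∀ y : ℤ, (y = n ∨ y = n + 1) → y ≤ N + 1 → ∀ x, 0 ≤ x → y - k ≤ x → x ≤ 2 * N + 1 →
      x ≤ 2 * N + 1 - (y - k) → F x y = H (x + y) + H (x - y) := by
    have edge : ∀ x y, 0 ≤ y → y ≤ N + 1 → (x = 0 ∨ x = 2 * N + 1) → F x y = H (x + y) + H (x - y) := by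
      intro x y hy hy2 hx
      rw [h0 x y (by omega)]
      symm; rw [z2]
      rcases hx with rfl | rfl
      · rw [zero_add, zero_sub, hH2 y (by omega) (by omega)]
      · exact hH3 y
    intro n
    induction n with
    | zero =>
      intro y hy hyN x hx1 hx2 hx3 hx4
      rcases hy with rfl | rfl
      · rw [Nat.cast_zero, h0 x 0 (by omega)]
        symm; rw [z2]; simp
      · by_cases hx : x = 0 ∨ x = 2 * N + 1
        · exact edge x _ (by simp) hyN hx
        · have := hH1 x (by omega) (by omega)
          simpa using this
    | succ n ih =>
      intro y hy hyN x hx1 hx2 hx3 hx4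
      rcases hy with rfl | rfl
      · exact ih _ (Or.inr (by push_cast; rfl)) hyN x hx1 hx2 hx3 hx4
      · push_cast at *
        by_cases hx : x = 0 ∨ x = 2 * N + 1
        · exact edge x _ (by omega) hyN hx
        · have e := h1 x (n + 1) (by omega)
          have a1 := ih (n + 1) (Or.inr rfl) (by omega) (x + 1) (by omega) (by omega) (by omega) (by omega)
          have a2 := ih (n + 1) (Or.inr rfl) (by omega) (x - 1) (by omega) (by omega) (by omega) (by omega)
          have a3 := ih n (Or.inl rfl) (by omega) x (by omega) (by omega) (by omega) (by omega)
          rw [show (n : ℤ) + 1 - 1 = n by ring, a1, a2, a3] at e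
          rw [show x + 1 + ((n : ℤ) + 1) = x + (n + 1 + 1) by ring,
            show x + 1 - ((n : ℤ) + 1) = x - n by ring,
            show x - 1 + ((n : ℤ) + 1) = x + n by ring,
            show x - 1 - ((n : ℤ) + 1) = x - (n + 1 + 1) by ring] at e
          revert e
          generalize F _ _ = u1
          generalize H _ = u2
          generalize H _ = u3
          generalize H _ = u4
          generalize H _ = u5
          revert u1 u2 u3 u4 u5
          decide
  have claim' : ∀ y : ℤ, 0 ≤ y → y ≤ N + 1 → ∀ x, 0 ≤ x → y - k ≤ x → x ≤ 2 * N + 1 →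
      x ≤ 2 * N + 1 - (y - k) → F x y = H (x + y) + H (x - y) := by
    intro y hy
    obtain ⟨n, rfl⟩ := Int.eq_ofNat_of_zero_le hy
    exact claim n _ (Or.inl rfl)
  have A : ∀ j, 0 ≤ j → j ≤ N - k → H (k + 2 * j) = H k := by
    intro j hj hj2
    have := claim' (k + j) (by omega) (by omega) j (by omega) (by omega) (by omega) (by omega)
    rw [h0 _ _ (by omega), eq_comm, z2] at this
    rw [← hH2 k (by omega) (by omega), show k + 2 * j = j + (k + j) by ring, this]
    congr 1; ring
  have B : ∀ j, 0 ≤ j → j ≤ N - k → H (2 * N + 1 - k - 2 * j) = H (2 * N + 1 - k) := by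
    intro j hj hj2
    have := claim' (k + j) (by omega) (by omega) (2 * N + 1 - j) (by omega) (by omega) (by omega) (by omega)
    rw [h0 _ _ (by omega), eq_comm, z2] at this
    rw [← hH3 k, show 2 * N + 1 - k - 2 * j = 2 * N + 1 - j - (k + j) by ring, ← this]
    congr 1; ring
  have T : ∀ m, -k ≤ m → m ≤ k - 1 → H m = H (2 * N - m) := by
    intro m hm hm2
    have := claim' (N + 1) (by omega) (by omega) (m + N + 1) (by omega) (by omega) (by omega) (by omega)
    rw [h0 _ _ (by omega), eq_comm, z2] at this
    rw [show m + N + 1 + (N + 1) = 2 * N + 1 + (m + 1) by ring, hH3] at this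
    rw [show m = m + N + 1 - (N + 1) by ring, ← this]
    congr 1; ring
  have D : ∀ m, 1 ≤ m → m ≤ k → H m = H (2 * N + 2 - m) := by
    intro m hm hm2
    have := T (-m) (by omega) (by omega)
    rw [hH2 m (by omega) (by omega)] at this
    rw [this, show 2 * N - -m = 2 * N + 1 + (m - 1) by ring, hH3]
    congr 1; ring
  have step : ∀ m, 0 ≤ m → m + 2 ≤ 2 * N + 1 → H (m + 2) = H m := by
    intro m hm hm2
    rcases lt_or_ge m (k - 1) with c | c
    · rw [T m (by omega) (by omega), D (m + 2) (by omega) (by omega)]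
      congr 1; ring
    rcases eq_or_lt_of_le c with c | c
    · rw [T m (by omega) (by omega)]
      have := B (N - k) (by omega) (by omega)
      rw [show m + 2 = 2 * N + 1 - k - 2 * (N - k) by omega, this]
      congr 1; omega
    rcases lt_or_ge m (2 * N - k) with c' | c'
    · rcases Int.even_or_odd' (m - k) with ⟨j, hj | hj⟩
      · have b1 := A j (by omega) (by omega)
        have b2 := A (j + 1) (by omega) (by omega)
        rw [show m + 2 = k + 2 * (j + 1) by omega, b2, ← b1]
        congr 1; omega
      · have b1 := B (N - k - j) (by omega) (by omega)
        have b2 := B (N - k - j - 1) (by omega) (by omega)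
        rw [show m + 2 = 2 * N + 1 - k - 2 * (N - k - j - 1) by omega, b2, ← b1]
        congr 1; omega
    rcases eq_or_lt_of_le c' with c' | c'
    · have b1 := A (N - k) (by omega) (by omega)
      have b2 := D k (by omega) (by omega)
      rw [show m + 2 = 2 * N + 2 - k by omega, ← b2, ← b1]
      congr 1; omega
    · have b1 := T (2 * N - m) (by omega) (by omega)
      have b2 := D (2 * N - m) (by omega) (by omega)
      rw [show m + 2 = 2 * N + 2 - (2 * N - m) by omega, ← b2, b1]
      congr 1; omega
  have const : ∀ n : ℕ, ∀ m, 0 ≤ m → m + 2 * n ≤ 2 * N + 1 → H (m + 2 * n) = H m := by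
    intro n
    induction n with
    | zero => intro m _ _; simp
    | succ n ih =>
      intro m hm hm2
      push_cast at *
      rw [← ih m hm (by omega), ← step (m + 2 * n) (by omega) (by omega)]
      congr 1; ring
  have const2 : ∀ a b, 0 ≤ a → a ≤ b → b ≤ 2 * N + 1 → (b - a) % 2 = 0 → H a = H b := by
    intro a b ha hab hb h
    have := const ((b - a) / 2).toNat a ha (by omega)
    rw [← this]; congr 1; omega
  have const3 : ∀ a b, 0 ≤ a → 0 ≤ b → a ≤ 2 * N + 1 → b ≤ 2 * N + 1 → (b - a) % 2 = 0 → H a = H b := by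
    intro a b ha hb ha' hb' h
    rcases le_total a b with c | c
    · exact const2 a b ha c hb' h
    · exact (const2 b a hb c ha' (by omega)).symm
  intro x y
  by_cases hR : (1 ≤ y ∧ y ≤ N ∧ 1 ≤ x ∧ y - k + 1 ≤ x ∧ x ≤ 2 * N ∧ x ≤ 2 * N - (y - k))
  · rw [claim' y (by omega) (by omega) x (by omega) (by omega) (by omega) (by omega), z2]
    obtain ⟨u, hu, hu1, hu2, hu3⟩ : ∃ u, H (x + y) = H u ∧ 0 ≤ u ∧ u ≤ 2 * N + 1 ∧ (u - (x + y)) % 2 = 0 := by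
      by_cases c : x + y ≤ 2 * N + 1
      · exact ⟨x + y, rfl, by omega, c, by omega⟩
      · refine ⟨2 * (2 * N + 1) - (x + y), ?_, by omega, by omega, by omega⟩
        have := hH3 (x + y - (2 * N + 1))
        rw [show x + y = 2 * N + 1 + (x + y - (2 * N + 1)) by ring, this]
        congr 1; ring
    obtain ⟨v, hv, hv1, hv2, hv3⟩ : ∃ u, H (x - y) = H u ∧ 0 ≤ u ∧ u ≤ 2 * N + 1 ∧ (u - (x - y)) % 2 = 0 := by
      by_cases c : 0 ≤ x - y
      · exact ⟨x - y, rfl, c, by omega, by omega⟩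
      · refine ⟨-(x - y), ?_, by omega, by omega, by omega⟩
        rw [← hH2 (-(x - y)) (by omega) (by omega), neg_neg]
    rw [hu, hv]
    exact const3 u v hu1 hv1 hu2 hv2 (by omega)
  · exact h0 x y hR

lemma treg_finite (i j p : ℕ) : (Treg i j p).Finite := by
  refine Set.Finite.subset (Set.finite_Icc ((-(p : ℤ) - 5, -5) : ℤ × ℤ)
    (2 * p + j + 5, i + p + 5)) ?_
  rintro ⟨c, r⟩ h
  simp only [Treg, Set.mem_ofPred_eq] at h
  simp only [Set.mem_Icc, Prod.mk_le_mk]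
  omega

theorem T_k_2k_odd (k p : ℕ) (hk : 0 < k) (hp : 0 < p) :
    Odd (numTilings (Treg k (2 * k) p)) := by
  classical
  have hfin := treg_finite k (2 * k) p
  generalize hR : Treg k (2 * k) p = R at hfin ⊢
  have : Fintype R := hfin.fintype
  rw [← count_tilings R, Nat.card_eq_fintype_card]
  have main := det_eq_count (V := R) (fun u v => Adjacent u.1 v.1) (fun a b h => adj_symm _ _ h)
  convert main ?_
  intro v hv
  let f : ℤ × ℤ → ZMod 2 := fun q => if h : q ∈ R then v ⟨q, h⟩ else 0
  have hsum : ∀ q ∈ R, f (q.1, q.2 - 1) + f (q.1, q.2 + 1) + f (q.1 + 1, q.2) + f (q.1 - 1, q.2) = 0 := by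
    intro q hq
    have e := hv ⟨q, hq⟩
    have e2 : ∑ x : R, (if Adjacent q x.1 then v x else 0)
        = ∑ x ∈ R.toFinset, (if Adjacent q x then f x else 0) := by
      rw [← Finset.sum_subtype_of_mem (p := fun x => x ∈ R) (s := R.toFinset)
        (fun x => if Adjacent q x then f x else 0) (by simp)]
      refine Finset.sum_bij (fun x _ => x) ?_ ?_ ?_ ?_
      · simp
      · simp
      · simp
      · intro x _
        simp [f]
    have e3 : ∑ x ∈ R.toFinset, (if Adjacent q x then f x else 0)
        = ∑ x ∈ ({(q.1, q.2 - 1), (q.1, q.2 + 1), (q.1 + 1, q.2), (q.1 - 1, q.2)} : Finset (ℤ × ℤ)), f x := by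
      rw [← Finset.sum_filter]
      apply Finset.sum_subset_zero_on_sdiff
      · rintro ⟨a, b⟩ hx
        rw [Finset.mem_filter] at hx
        simp only [Adjacent] at hx
        simp only [Finset.mem_insert, Finset.mem_singleton, Prod.mk.injEq]
        omega
      · rintro ⟨a, b⟩ hx
        rw [Finset.mem_sdiff, Finset.mem_filter] at hx
        simp only [Adjacent, Set.mem_toFinset, Finset.mem_insert,
          Finset.mem_singleton, Prod.mk.injEq] at hx
        have : (a, b) ∉ R := fun h => hx.2 ⟨h, by omega⟩
        simp [f, this]
      · intros; rfl
    rw [e2, e3, Finset.sum_insert, Finset.sum_insert, Finset.sum_insert, Finset.sum_singleton] at e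
    · rw [← e]; ring
    all_goals
      simp only [Finset.mem_insert, Finset.mem_singleton, Prod.mk.injEq]
      omega
  have hmem : ∀ x y : ℤ, (x - 1, (k : ℤ) + p - 1 - y) ∈ R ↔
      (1 ≤ y ∧ y ≤ (k : ℤ) + p - 1 ∧ 1 ≤ x ∧ y - k + 1 ≤ x ∧ x ≤ 2 * ((k : ℤ) + p - 1) ∧
        x ≤ 2 * ((k : ℤ) + p - 1) - (y - k)) := by
    intro x y
    rw [← hR]
    simp only [Treg, Set.mem_ofPred_eq]
    push_cast
    omega
  have K := kernel_trivial k (k + p - 1) (by omega) (by omega)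
    (fun x y => f (x - 1, (k : ℤ) + p - 1 - y))
    (fun x y h => by
      rw [← hmem] at h
      simp [f, h])
    (fun x y h => by
      rw [← hmem] at h
      have := hsum _ h
      simp only at this ⊢
      rw [← this]
      ring_nf)
  funext q
  have := K (q.1.1 + 1) ((k : ℤ) + p - 1 - q.1.2)
  simpa [f] using this
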